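/- Let κ ≠ 0 be a real number, let Ω ⊆ {(t,x) ∈ ℝ² : t + x > 0} be open, and let u : ℝ² → ℝ be C³ on Ω satisfying the Euler–Poisson equation (EP) on Ω. Then the function v(t,x) = u_x(t,x) − u(t,x)/(κ(t+x)) satisfies the transformed equation (EP') on Ω: v_{tx} = (1−2κ)·v_t/(κ(t+x)) + 2(1−κ)·v_x/(κ(t+x)) − (2κ−1)(κ−2)·v/(κ(t+x))². -/

import Mathlib

open Real Set

/-- Partial derivative with respect to the first variable. -/
noncomputable def pdt (f : ℝ × ℝ → ℝ) (p : ℝ × ℝ) : ℝ :=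
  deriv (fun s => f (s, p.2)) p.1

/-- Partial derivative with respect to the second variable. -/
noncomputable def pdx (f : ℝ × ℝ → ℝ) (p : ℝ × ℝ) : ℝ :=
  deriv (fun s => f (p.1, s)) p.2

section PartialDerivatives

variable {f : ℝ × ℝ → ℝ} {p : ℝ × ℝ} {Ω : Set (ℝ × ℝ)}

theorem hasDerivAt_fst_slice (hf : DifferentiableAt ℝ f p) :
    HasDerivAt (fun s => f (s, p.2)) (fderiv ℝ f p (1, 0)) p.1 :=
  hf.hasFDerivAt.comp_hasDerivAt (f := fun s : ℝ => (s, p.2)) p.1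
    ((hasDerivAt_id p.1).prodMk (hasDerivAt_const p.1 p.2))

theorem hasDerivAt_snd_slice (hf : DifferentiableAt ℝ f p) :
    HasDerivAt (fun s => f (p.1, s)) (fderiv ℝ f p (0, 1)) p.2 :=
  hf.hasFDerivAt.comp_hasDerivAt (f := fun s : ℝ => (p.1, s)) p.2
    ((hasDerivAt_const p.2 p.1).prodMk (hasDerivAt_id p.2))

theorem pdt_eq_fderiv (hf : DifferentiableAt ℝ f p) : pdt f p = fderiv ℝ f p (1, 0) :=
  (hasDerivAt_fst_slice hf).deriv

theorem pdx_eq_fderiv (hf : DifferentiableAt ℝ f p) : pdx f p = fderiv ℝ f p (0, 1) :=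
  (hasDerivAt_snd_slice hf).deriv

theorem hasDerivAt_pdt (hf : DifferentiableAt ℝ f p) :
    HasDerivAt (fun s => f (s, p.2)) (pdt f p) p.1 :=
  pdt_eq_fderiv hf ▸ hasDerivAt_fst_slice hf

theorem hasDerivAt_pdx (hf : DifferentiableAt ℝ f p) :
    HasDerivAt (fun s => f (p.1, s)) (pdx f p) p.2 :=
  pdx_eq_fderiv hf ▸ hasDerivAt_snd_slice hf

theorem ContDiffOn.differentiableAt_of_isOpen {n : WithTop ℕ∞} (hf : ContDiffOn ℝ n f Ω)
    (hn : n ≠ 0) (hΩ : IsOpen Ω) (hp : p ∈ Ω) : DifferentiableAt ℝ f p :=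
  (hf.contDiffAt (hΩ.mem_nhds hp)).differentiableAt hn

theorem contDiffOn_pdt {m n : WithTop ℕ∞} (hf : ContDiffOn ℝ n f Ω) (hΩ : IsOpen Ω)
    (hmn : m + 1 ≤ n) : ContDiffOn ℝ m (pdt f) Ω :=
  ((hf.fderiv_of_isOpen hΩ hmn).clm_apply contDiffOn_const).congr fun _ hq =>
    pdt_eq_fderiv (hf.differentiableAt_of_isOpen (by rintro rfl; simp at hmn) hΩ hq)

theorem contDiffOn_pdx {m n : WithTop ℕ∞} (hf : ContDiffOn ℝ n f Ω) (hΩ : IsOpen Ω)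
    (hmn : m + 1 ≤ n) : ContDiffOn ℝ m (pdx f) Ω :=
  ((hf.fderiv_of_isOpen hΩ hmn).clm_apply contDiffOn_const).congr fun _ hq =>
    pdx_eq_fderiv (hf.differentiableAt_of_isOpen (by rintro rfl; simp at hmn) hΩ hq)

/-- Mixed second partial derivatives of a `C²` function on an open set commute. -/
theorem pdt_pdx_comm (hf : ContDiffOn ℝ 2 f Ω) (hΩ : IsOpen Ω) (hp : p ∈ Ω) :
    pdt (pdx f) p = pdx (pdt f) p := by
  have hd : ∀ q ∈ Ω, DifferentiableAt ℝ f q := fun q hq =>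
    hf.differentiableAt_of_isOpen two_ne_zero hΩ hq
  have hΩp : Ω ∈ nhds p := hΩ.mem_nhds hp
  have hdf : DifferentiableAt ℝ (fderiv ℝ f) p :=
    ((hf.fderiv_of_isOpen hΩ (m := 1) (by norm_num)).contDiffAt hΩp).differentiableAt one_ne_zero
  have hx : pdx f =ᶠ[nhds p] fun q => fderiv ℝ f q (0, 1) := by
    filter_upwards [hΩp] with q hq using pdx_eq_fderiv (hd q hq)
  have ht : pdt f =ᶠ[nhds p] fun q => fderiv ℝ f q (1, 0) := by
    filter_upwards [hΩp] with q hq using pdt_eq_fderiv (hd q hq)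
  have happly : ∀ w : ℝ × ℝ, HasFDerivAt (fun q => fderiv ℝ f q w)
      ((fderiv ℝ (fderiv ℝ f) p).flip w) p := fun w => by
    simpa using hdf.hasFDerivAt.clm_apply (hasFDerivAt_const w p)
  have hx' := (happly (0, 1)).congr_of_eventuallyEq hx
  have ht' := (happly (1, 0)).congr_of_eventuallyEq ht
  rw [pdt_eq_fderiv hx'.differentiableAt, pdx_eq_fderiv ht'.differentiableAt, hx'.fderiv,
    ht'.fderiv]
  exact ((hf.contDiffAt hΩp).isSymmSndFDerivAt (by simp)).eq (1, 0) (0, 1)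

end PartialDerivatives

/-- The Laplace transformation v = u_x - u/(κ(t+x)) takes solutions of the
Euler–Poisson equation (EP) to solutions of the transformed equation (EP'). -/
theorem laplace_transformation_of_euler_poisson
    (κ : ℝ) (hκ : κ ≠ 0)
    (Ω : Set (ℝ × ℝ)) (hΩopen : IsOpen Ω)
    (hΩpos : ∀ p ∈ Ω, 0 < p.1 + p.2)
    (u : ℝ × ℝ → ℝ) (hu : ContDiffOn ℝ 3 u Ω)
    (hEP : ∀ p ∈ Ω, pdt (pdx u) p =
      pdt u p / (κ * (p.1 + p.2))
      + 2 * (1 - κ) * pdx u p / (κ * (p.1 + p.2))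
      - 2 * (1 - κ) * u p / (κ * (p.1 + p.2)) ^ 2)
    (v : ℝ × ℝ → ℝ)
    (hv : ∀ q : ℝ × ℝ, v q = pdx u q - u q / (κ * (q.1 + q.2))) :
    ∀ p ∈ Ω,
      pdt (pdx v) p =
        (1 - 2 * κ) * pdt v p / (κ * (p.1 + p.2))
        + 2 * (1 - κ) * pdx v p / (κ * (p.1 + p.2))
        - (2 * κ - 1) * (κ - 2) * v p / (κ * (p.1 + p.2)) ^ 2 := by
  intro p hp
  have hs : ∀ q ∈ Ω, κ * (q.1 + q.2) ≠ 0 := fun q hq => mul_ne_zero hκ (hΩpos q hq).ne'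
  have hux : ContDiffOn ℝ 2 (pdx u) Ω := contDiffOn_pdx hu hΩopen (by norm_num)
  have hv2 : ContDiffOn ℝ 2 v Ω :=
    (hux.sub ((hu.of_le (by norm_num)).div (by fun_prop) hs)).congr fun q _ => hv q
  have hvt1 : ContDiffOn ℝ 1 (pdt v) Ω := contDiffOn_pdt hv2 hΩopen (by norm_num)
  have hud : ∀ q ∈ Ω, DifferentiableAt ℝ u q := fun q hq =>
    hu.differentiableAt_of_isOpen three_ne_zero hΩopen hq
  have hvt : ∀ q ∈ Ω, κ * u q = (κ * (q.1 + q.2)) ^ 2 * pdt v q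
      - 2 * (1 - κ) * (κ * (q.1 + q.2)) * v q := by
    intro q hq
    have hsq := hs q hq
    have hlin : HasDerivAt (fun s => κ * (s + q.2)) κ q.1 := by
      simpa using ((hasDerivAt_id q.1).add_const q.2).const_mul κ
    have hderiv := (hasDerivAt_pdt (hux.differentiableAt_of_isOpen two_ne_zero hΩopen hq)).sub
      ((hasDerivAt_pdt (hud q hq)).div hlin hsq)
    have hpdt : pdt v q = pdt (pdx u) q
        - (pdt u q * (κ * (q.1 + q.2)) - u q * κ) / (κ * (q.1 + q.2)) ^ 2 := by
      rw [pdt, funext fun s => hv (s, q.2)]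
      exact hderiv.deriv
    rw [hpdt, hv q, hEP q hq]
    generalize κ * (q.1 + q.2) = s at hsq ⊢
    field_simp
    ring
  have hsp := hs p hp
  have hlin : HasDerivAt (fun s => κ * (p.1 + s)) κ p.2 := by
    simpa using ((hasDerivAt_id p.2).const_add p.1).const_mul κ
  have hright := ((hlin.pow 2).mul (hasDerivAt_pdx
    (hvt1.differentiableAt_of_isOpen one_ne_zero hΩopen hp))).sub
    ((hlin.const_mul (2 * (1 - κ))).mul (hasDerivAt_pdx
      (hv2.differentiableAt_of_isOpen two_ne_zero hΩopen hp)))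
  have hleft := (hasDerivAt_pdx (hud p hp)).const_mul κ
  have hnear : ∀ᶠ s in nhds p.2, (p.1, s) ∈ Ω :=
    (Continuous.prodMk_right p.1).continuousAt.eventually (hΩopen.mem_nhds hp)
  have hux_eq := hleft.unique (hright.congr_of_eventuallyEq
    (hnear.mono fun s hmem => hvt (p.1, s) hmem))
  have hup := hvt p hp
  rw [pdt_pdx_comm hv2 hΩopen hp]
  have huxp : pdx u p = v p + u p / (κ * (p.1 + p.2)) := by rw [hv p]; ring
  have hup' : κ * (u p / (κ * (p.1 + p.2))) =
      κ * (p.1 + p.2) * pdt v p - 2 * (1 - κ) * v p := by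
    rw [← mul_div_assoc, hup, div_eq_iff hsp]
    ring
  rw [huxp, mul_add, hup'] at hux_eq
  simp only [Nat.cast_ofNat, Nat.add_one_sub_one, pow_one, Pi.pow_apply, Prod.mk.eta] at hux_eq
  generalize κ * (p.1 + p.2) = s at hsp hux_eq ⊢
  field_simp
  linarith
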